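/- If 𝓘 is an ideal of graphs such that both 𝓘 and the ideal of complements of members of 𝓘 are incoherent (i.e., for some ε > 0 no member is ε-coherent), and 𝓘 is proper, then there exists c > 0 such that every graph G ∈ 𝓘 satisfies ω(G)·α(G) ≥ |G|^c. -/

import Mathlib

/-- A finite graph, presented as a number of vertices together with a graph on `Fin n`. -/
abbrev GraphOn := Σ n : ℕ, SimpleGraph (Fin n)

/-- `H` is (isomorphic to) an induced subgraph of `G`. -/
def Embeds (H G : GraphOn) : Prop :=
  ∃ f : Fin H.1 → Fin G.1, Function.Injective f ∧
    ∀ a b, H.2.Adj a b ↔ G.2.Adj (f a) (f b)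

/-- An ideal: a class of finite graphs closed under (isomorphism and) induced subgraphs. -/
def IsIdeal (I : Set GraphOn) : Prop :=
  ∀ G ∈ I, ∀ H : GraphOn, Embeds H G → H ∈ I

/-- The clique number ω(G). -/
noncomputable def gOmega (G : GraphOn) : ℕ :=
  sSup {k | ∃ s : Finset (Fin G.1), G.2.IsNClique k s}

/-- The independence number α(G). -/
noncomputable def gAlpha (G : GraphOn) : ℕ :=
  sSup {k | ∃ s : Finset (Fin G.1), G.2ᶜ.IsNClique k s}

/-- Complementation on `GraphOn`. -/
def gCompl (G : GraphOn) : GraphOn := ⟨G.1, G.2ᶜ⟩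

/-- `G` is ε-coherent: at least two vertices, all degrees less than `ε|G|`, and every
pair of disjoint anticomplete sets `A, B` has `min(|A|,|B|) < ε|G|`. -/
def Coherent {n : ℕ} (G : SimpleGraph (Fin n)) (ε : ℝ) : Prop :=
  2 ≤ n ∧ (∀ v, ((G.neighborSet v).ncard : ℝ) < ε * n) ∧
  ∀ A B : Finset (Fin n), Disjoint A B → (∀ a ∈ A, ∀ b ∈ B, ¬ G.Adj a b) →
    (min A.card B.card : ℝ) < ε * n

open Finset Classical in
/-- real-valued adjacency indicator -/
noncomputable def adjW {V : Type} (G : SimpleGraph V) (u v : V) : ℝ :=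
  if G.Adj u v then 1 else 0

/-- ordered edge count between two sets -/
noncomputable def eW {V : Type} (G : SimpleGraph V) (A B : Finset V) : ℝ :=
  ∑ a ∈ A, ∑ b ∈ B, adjW G a b

lemma adjW_nonneg {V : Type} (G : SimpleGraph V) (u v : V) : 0 ≤ adjW G u v := by
  unfold adjW; split_ifs <;> norm_num

lemma adjW_le_one {V : Type} (G : SimpleGraph V) (u v : V) : adjW G u v ≤ 1 := by
  unfold adjW; split_ifs <;> norm_num

lemma adjW_self {V : Type} (G : SimpleGraph V) (u : V) : adjW G u u = 0 := by
  simp [adjW]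

lemma adjW_comm {V : Type} (G : SimpleGraph V) (u v : V) : adjW G u v = adjW G v u := by
  unfold adjW
  by_cases h : G.Adj u v
  · rw [if_pos h, if_pos h.symm]
  · rw [if_neg h, if_neg fun h' => h h'.symm]

lemma eW_comm {V : Type} (G : SimpleGraph V) (A B : Finset V) : eW G A B = eW G B A := by
  unfold eW
  rw [Finset.sum_comm]
  simp_rw [adjW_comm G]

lemma eW_nonneg {V : Type} (G : SimpleGraph V) (A B : Finset V) : 0 ≤ eW G A B :=
  Finset.sum_nonneg fun _ _ => Finset.sum_nonneg fun _ _ => adjW_nonneg _ _ _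

lemma eW_le {V : Type} (G : SimpleGraph V) (A B : Finset V) :
    eW G A B ≤ (A.card : ℝ) * B.card := by
  unfold eW
  calc _ ≤ ∑ a ∈ A, ∑ b ∈ B, (1 : ℝ) :=
        Finset.sum_le_sum fun _ _ => Finset.sum_le_sum fun _ _ => adjW_le_one _ _ _
    _ = _ := by simp

open Classical in
lemma eW_union {V : Type} (G : SimpleGraph V) (A B : Finset V) (h : Disjoint A B) :
    eW G (A ∪ B) (A ∪ B) = eW G A A + eW G B B + 2 * eW G A B := by
  have h1 : eW G (A ∪ B) (A ∪ B) = eW G A A + eW G A B + (eW G B A + eW G B B) := by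
    unfold eW
    rw [Finset.sum_union h]
    simp_rw [Finset.sum_union h, Finset.sum_add_distrib]
  rw [h1, eW_comm G B A]; ring

open Classical in
lemma trim_one {V : Type} (G : SimpleGraph V) (a : ℝ) (ha : 0 ≤ a) (X : Finset V)
    (hX : eW G X X ≤ a * (X.card : ℝ) ^ 2) (hne : X.Nonempty) :
    ∃ Y ⊆ X, Y.card + 1 = X.card ∧ eW G Y Y ≤ a * (Y.card : ℝ) ^ 2 := by
  obtain ⟨v, hv, hd⟩ : ∃ v ∈ X, eW G X X ≤ X.card * ∑ b ∈ X, adjW G v b := by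
    by_contra! hcon
    have : ∑ v ∈ X, (X.card : ℝ) * ∑ b ∈ X, adjW G v b < ∑ v ∈ X, eW G X X :=
      Finset.sum_lt_sum_of_nonempty hne hcon
    rw [← Finset.mul_sum, Finset.sum_const, nsmul_eq_mul] at this
    exact lt_irrefl _ this
  refine ⟨X.erase v, Finset.erase_subset _ _, Finset.card_erase_add_one hv, ?_⟩
  have hc : ((X.erase v).card : ℝ) = X.card - 1 := by
    have := Finset.card_erase_add_one hv
    rw [← this]; push_cast; ring
  have hsplit : eW G X X = eW G (X.erase v) (X.erase v) + 2 * ∑ b ∈ X, adjW G v b := by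
    have hX' : X = {v} ∪ X.erase v := by
      rw [← Finset.insert_eq, Finset.insert_erase hv]
    have hdis : Disjoint {v} (X.erase v) := by simp
    have h2 := eW_union G {v} (X.erase v) hdis
    rw [← hX'] at h2
    rw [h2]
    have h3 : ∑ b ∈ X, adjW G v b = ∑ b ∈ X.erase v, adjW G v b := by
      rw [← Finset.add_sum_erase _ _ hv, adjW_self, zero_add]
    rw [h3]
    simp [eW, adjW_self]
  rw [hc]
  have h0 := eW_nonneg G X X
  have hn1 : (1 : ℝ) ≤ X.card := by exact_mod_cast hne.card_pos
  by_cases h2 : 2 ≤ X.card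
  · have h2' : (2 : ℝ) ≤ X.card := by exact_mod_cast h2
    set n : ℝ := (X.card : ℝ)
    set d := ∑ b ∈ X, adjW G v b
    set e' := eW G (X.erase v) (X.erase v)
    have : n * e' ≤ n * (a * (n - 1) ^ 2) := by
      have h5 : n * e' ≤ (n - 2) * eW G X X := by nlinarith
      have h6 : (n - 2) * eW G X X ≤ (n - 2) * (a * n ^ 2) :=
        mul_le_mul_of_nonneg_left hX (by linarith)
      have h7 : 0 ≤ n * a := by positivity
      nlinarith
    exact le_of_mul_le_mul_left this (by linarith)
  · have : (X.erase v).card = 0 := by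
      have := Finset.card_erase_add_one hv; omega
    rw [Finset.card_eq_zero] at this
    rw [this]; simp [eW]; positivity

lemma trim {V : Type} (G : SimpleGraph V) (a : ℝ) (ha : 0 ≤ a) (m : ℕ) : ∀ (d : ℕ) (X : Finset V),
    X.card = m + d → eW G X X ≤ a * (X.card : ℝ) ^ 2 →
    ∃ Y ⊆ X, Y.card = m ∧ eW G Y Y ≤ a * (Y.card : ℝ) ^ 2 := by
  intro d
  induction d with
  | zero => intro X h1 h2; exact ⟨X, subset_rfl, h1, h2⟩
  | succ d ih =>
    intro X h1 h2
    obtain ⟨Y, hY, hc, he⟩ := trim_one G a ha X h2 (Finset.card_pos.1 (by omega))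
    obtain ⟨Z, hZ, hZ2⟩ := ih Y (by omega) he
    exact ⟨Z, hZ.trans hY, hZ2⟩

open Classical in
lemma sum_adjW {V : Type} (G : SimpleGraph V) (v : V) (B : Finset V) :
    ∑ b ∈ B, adjW G v b = ((B.filter fun b => G.Adj v b).card : ℝ) := by
  simp [adjW]

/-- `A` is sparse to `B`. -/
def SparseTo {V : Type} (G : SimpleGraph V) (η : ℝ) (A B : Finset V) : Prop :=
  ∀ a ∈ A, ∑ b ∈ B, adjW G a b ≤ η * B.card

open Classical in
lemma EH (η : ℝ) (hη : 0 < η) : ∀ k : ℕ, ∃ γ : ℝ, 0 < γ ∧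
    ∀ (V : Type) (G : SimpleGraph V) (H : SimpleGraph (Fin k)) (P : Fin k → Finset V) (M : ℝ),
      0 < M → (∀ i, M ≤ (P i).card) →
      (∃ f : Fin k → V, (∀ i, f i ∈ P i) ∧ ∀ i j, i ≠ j → (H.Adj i j ↔ G.Adj (f i) (f j))) ∨
      ∃ i j, i ≠ j ∧ ∃ A ⊆ P i, ∃ B ⊆ P j, γ * M ≤ A.card ∧ γ * M ≤ B.card ∧
        (SparseTo G η A B ∨ SparseTo Gᶜ η A B) := by
  intro k
  induction k with
  | zero => exact ⟨1, one_pos, fun V G H P M _ _ => Or.inl ⟨fun i => i.elim0, fun i => i.elim0, fun i => i.elim0⟩⟩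
  | succ k ih =>
    obtain ⟨γ, hγ, ih⟩ := ih
    refine ⟨min (γ * η) (1 / (k + 1)), by positivity, ?_⟩
    intro V G H P M hM hP
    let N : V → Fin k → Finset V := fun v j =>
      (P j.succ).filter fun b => (H.Adj 0 j.succ ↔ G.Adj v b)
    by_cases hgood : ∃ v ∈ P 0, ∀ j : Fin k, η * (P j.succ).card ≤ (N v j).card
    · obtain ⟨v, hv, hN⟩ := hgood
      rcases ih V G (H.comap Fin.succ) (N v) (η * M) (by positivity)
        (fun i => (mul_le_mul_of_nonneg_left (hP i.succ) hη.le).trans (hN i)) with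
        ⟨f, hf, hadj⟩ | ⟨i, j, hij, A, hA, B, hB, h1, h2, h3⟩
      · left
        refine ⟨Fin.cons v f, ?_, ?_⟩
        · intro i
          refine Fin.cases ?_ (fun i => ?_) i
          · simpa using hv
          · simpa using (Finset.mem_filter.1 (hf i)).1
        · intro i j
          refine Fin.cases ?_ (fun i => ?_) i
          · refine Fin.cases ?_ (fun j => ?_) j
            · intro h; exact absurd rfl h
            · intro _; simpa using (Finset.mem_filter.1 (hf j)).2
          · refine Fin.cases ?_ (fun j => ?_) j
            · intro _
              rw [H.adj_comm, G.adj_comm]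
              simpa using (Finset.mem_filter.1 (hf i)).2
            · intro h
              simpa using hadj i j (fun h' => h (by rw [h']))
      · right
        have hle : min (γ * η) (1 / ((k : ℝ) + 1)) * M ≤ γ * (η * M) := by
          rw [← mul_assoc]
          exact mul_le_mul_of_nonneg_right (min_le_left _ _) hM.le
        exact ⟨i.succ, j.succ, fun h => hij (Fin.succ_injective _ h), A,
          hA.trans (Finset.filter_subset _ _), B, hB.trans (Finset.filter_subset _ _),
          hle.trans h1, hle.trans h2, h3⟩
    · right
      push Not at hgood
      have hlt : ∃ j : Fin k, (P 0).card ≤ k * ((P 0).filter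
          fun v => ((N v j).card : ℝ) < η * (P j.succ).card).card := by
        by_contra! hcon
        have hsub : P 0 ⊆ (Finset.univ : Finset (Fin k)).biUnion fun j => (P 0).filter
          fun v => ((N v j).card : ℝ) < η * (P j.succ).card := by
          intro v hv
          obtain ⟨j, hj⟩ := hgood v hv
          simp only [Finset.mem_biUnion, Finset.mem_univ, true_and, Finset.mem_filter]
          exact ⟨j, hv, hj⟩
        have h1 := (Finset.card_le_card hsub).trans Finset.card_biUnion_le
        have hpos : 0 < (P 0).card := by
          have := lt_of_lt_of_le hM (hP 0); exact_mod_cast this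
        obtain ⟨v, hv⟩ := Finset.card_pos.1 hpos
        obtain ⟨j0, -⟩ := hgood v hv
        have h2 := Finset.sum_lt_sum_of_nonempty (s := (Finset.univ : Finset (Fin k)))
          ⟨j0, Finset.mem_univ _⟩ (fun j _ => hcon j)
        rw [← Finset.mul_sum] at h2
        simp only [Finset.sum_const, Finset.card_univ, Fintype.card_fin, smul_eq_mul] at h2
        have h3 := Nat.mul_le_mul_left k h1
        omega
      obtain ⟨j, hj⟩ := hlt
      set A := (P 0).filter fun v => ((N v j).card : ℝ) < η * (P j.succ).card with hA
      have hle1 : min (γ * η) (1 / ((k : ℝ) + 1)) * M ≤ 1 / ((k : ℝ) + 1) * M :=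
        mul_le_mul_of_nonneg_right (min_le_right _ _) hM.le
      have hk : (0 : ℝ) < (k : ℝ) + 1 := by positivity
      refine ⟨0, j.succ, (Fin.succ_ne_zero j).symm, A, Finset.filter_subset _ _, P j.succ,
        subset_rfl, hle1.trans ?_, hle1.trans ?_, ?_⟩
      · rw [one_div_mul_eq_div, div_le_iff₀ hk]
        have : ((P 0).card : ℝ) ≤ k * A.card := by exact_mod_cast hj
        have h0 : (0 : ℝ) ≤ A.card := by positivity
        nlinarith [hP 0]
      · rw [one_div_mul_eq_div, div_le_iff₀ hk]
        have h0 : (0 : ℝ) ≤ k := by positivity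
        nlinarith [hP j.succ]
      · by_cases hH : H.Adj 0 j.succ
        · left
          intro a ha
          rw [sum_adjW]
          have := (Finset.mem_filter.1 ha).2
          simp only [N, hH, true_iff] at this
          exact this.le
        · right
          intro a ha
          rw [sum_adjW]
          have := (Finset.mem_filter.1 ha).2
          simp only [N, hH, false_iff] at this
          refine le_trans ?_ this.le
          refine Nat.cast_le.2 (Finset.card_le_card ?_)
          intro b hb
          have hmem := @Finset.mem_filter _ _ (_) _ _ |>.1 hb
          exact Finset.mem_filter.2 ⟨hmem.1, hmem.2.2⟩

/-- vertices with degree at most twice average are at least half. -/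
lemma half_low {V : Type} (G : SimpleGraph V) (t : ℝ) (A B : Finset V) (ht : 0 < t)
    (hA : A.Nonempty) (h : eW G A B ≤ t * A.card * B.card) :
    ∃ B1 ⊆ B, (B.card : ℝ) / 2 ≤ B1.card ∧ ∀ b ∈ B1, ∑ a ∈ A, adjW G b a ≤ 2 * t * A.card := by
  classical
  refine ⟨B.filter fun b => ∑ a ∈ A, adjW G b a ≤ 2 * t * A.card, Finset.filter_subset _ _, ?_,
    fun b hb => (Finset.mem_filter.1 hb).2⟩
  have hpos : (0 : ℝ) < A.card := by exact_mod_cast hA.card_pos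
  set C := B.filter fun b => ¬ ∑ a ∈ A, adjW G b a ≤ 2 * t * A.card with hC
  have hs := Finset.card_filter_add_card_filter_not (s := B) (fun b => ∑ a ∈ A, adjW G b a ≤ 2 * t * A.card)
  have hs' : ((B.filter fun b => ∑ a ∈ A, adjW G b a ≤ 2 * t * A.card).card : ℝ) + C.card = B.card := by
    exact_mod_cast hs
  have h1 : (C.card : ℝ) * (2 * t * A.card) ≤ eW G B A := by
    unfold eW
    calc (C.card : ℝ) * (2 * t * A.card) = ∑ b ∈ C, (2 * t * A.card) := by simp
      _ ≤ ∑ b ∈ C, ∑ a ∈ A, adjW G b a :=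
        Finset.sum_le_sum fun b hb => (not_le.1 (Finset.mem_filter.1 hb).2).le
      _ ≤ _ := Finset.sum_le_sum_of_subset_of_nonneg (Finset.filter_subset _ _)
        fun _ _ _ => Finset.sum_nonneg fun _ _ => adjW_nonneg _ _ _
  rw [eW_comm] at h1
  have h2 := h1.trans h
  have h3 : (t * A.card) * (2 * C.card) ≤ (t * A.card) * B.card := by nlinarith
  have h4 := le_of_mul_le_mul_left h3 (by positivity)
  linarith

open Classical in
lemma combine {V : Type} (G : SimpleGraph V) (a δ s : ℝ) (ha : 0 < a) (hδ : 0 < δ) (hs : 0 < s)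
    (D : Finset V → Prop) (A B : Finset V) (hAB : Disjoint A B)
    (hR : ∀ T : Finset V, ∃ X ⊆ T, δ * T.card ≤ X.card ∧
      (eW G X X ≤ (3 / 2 * a) * (X.card : ℝ) ^ 2 ∨ D X))
    (hA : s ≤ A.card) (hB : s ≤ B.card) (hsp : SparseTo G (a / 4) A B) :
    ∃ X ⊆ A ∪ B, δ * s / 2 ≤ X.card ∧ (eW G X X ≤ a * (X.card : ℝ) ^ 2 ∨ D X) := by
  classical
  obtain ⟨A1, hA1, hA1c, h | h⟩ := hR A
  swap
  · refine ⟨A1, hA1.trans Finset.subset_union_left, ?_, Or.inr h⟩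
    have : δ * s ≤ δ * A.card := mul_le_mul_of_nonneg_left hA hδ.le
    have : 0 < δ * s := by positivity
    linarith
  have hδs : 0 < δ * s := by positivity
  have hm1 : δ * s ≤ A1.card := (mul_le_mul_of_nonneg_left hA hδ.le).trans hA1c
  set m := ⌈δ * s / 2⌉₊ with hm
  have hmA : m ≤ A1.card := Nat.ceil_le.2 (by linarith)
  have hmpos : 0 < m := Nat.ceil_pos.2 (by linarith)
  have hmge : δ * s / 2 ≤ m := Nat.le_ceil _
  obtain ⟨A2, hA2, hA2c, hA2e⟩ := trim G (3 / 2 * a) (by positivity) m (A1.card - m) A1 (by omega) h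
  have hA2A : A2 ⊆ A := hA2.trans hA1
  have he : eW G A2 B ≤ a / 4 * A2.card * B.card := by
    unfold eW
    calc _ ≤ ∑ x ∈ A2, a / 4 * (B.card : ℝ) := Finset.sum_le_sum fun x hx => hsp x (hA2A hx)
      _ = _ := by simp; ring
  obtain ⟨B1, hB1, hB1c, hB1d⟩ := half_low G (a / 4) A2 B (by positivity)
    (Finset.card_pos.1 (by omega)) he
  obtain ⟨B2, hB2, hB2c, h' | h'⟩ := hR B1
  swap
  · refine ⟨B2, (hB2.trans hB1).trans Finset.subset_union_right, ?_, Or.inr h'⟩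
    have : δ * (s / 2) ≤ δ * B1.card := mul_le_mul_of_nonneg_left (by linarith) hδ.le
    linarith
  have hm2 : δ * s / 2 ≤ B2.card := by
    have : δ * (s / 2) ≤ δ * B1.card := mul_le_mul_of_nonneg_left (by linarith) hδ.le
    linarith
  have hmB : m ≤ B2.card := Nat.ceil_le.2 hm2
  obtain ⟨B3, hB3, hB3c, hB3e⟩ := trim G (3 / 2 * a) (by positivity) m (B2.card - m) B2 (by omega) h'
  have hB3B : B3 ⊆ B := (hB3.trans hB2).trans hB1
  have hdis : Disjoint A2 B3 := Finset.disjoint_of_subset_left hA2A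
    (Finset.disjoint_of_subset_right hB3B hAB)
  have hcard : ((A2 ∪ B3).card : ℝ) = 2 * m := by
    rw [Finset.card_union_of_disjoint hdis, hA2c, hB3c]; push_cast; ring
  refine ⟨A2 ∪ B3, Finset.union_subset_union hA2A hB3B, ?_, Or.inl ?_⟩
  · rw [hcard]; linarith
  · rw [eW_union G _ _ hdis, hcard]
    have hx : eW G B3 A2 ≤ a / 2 * m * m := by
      unfold eW
      calc _ ≤ ∑ x ∈ B3, 2 * (a / 4) * (A2.card : ℝ) :=
            Finset.sum_le_sum fun x hx => hB1d x (hB2 (hB3 hx))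
        _ = _ := by simp [hA2c, hB3c]; ring
    rw [eW_comm G A2 B3]
    rw [hA2c] at hA2e
    rw [hB3c] at hB3e
    nlinarith

lemma exists_parts {V : Type} (m : ℕ) : ∀ (k : ℕ) (S : Finset V), k * m ≤ S.card →
    ∃ P : Fin k → Finset V, (∀ i, P i ⊆ S) ∧ (∀ i, (P i).card = m) ∧
      ∀ i j, i ≠ j → Disjoint (P i) (P j) := by
  classical
  intro k
  induction k with
  | zero => intro S _; exact ⟨fun i => i.elim0, fun i => i.elim0, fun i => i.elim0, fun i => i.elim0⟩
  | succ k ih =>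
    intro S hS
    rw [add_mul, one_mul] at hS
    obtain ⟨T, hT, hTc⟩ := Finset.exists_subset_card_eq (show m ≤ S.card by omega)
    obtain ⟨P, h1, h2, h3⟩ := ih (S \ T) (by rw [Finset.card_sdiff_of_subset hT]; omega)
    have hd : ∀ i, Disjoint T (P i) := fun i =>
      Finset.disjoint_of_subset_right (h1 i) Finset.disjoint_sdiff
    refine ⟨Fin.cons T P, ?_, ?_, ?_⟩
    · intro i
      refine Fin.cases ?_ (fun i => ?_) i
      · simpa using hT
      · simpa using (h1 i).trans Finset.sdiff_subset
    · intro i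
      refine Fin.cases ?_ (fun i => ?_) i
      · simpa using hTc
      · simpa using h2 i
    · intro i j
      refine Fin.cases ?_ (fun i => ?_) i
      · refine Fin.cases ?_ (fun j => ?_) j
        · intro h; exact absurd rfl h
        · intro _; simpa using hd j
      · refine Fin.cases ?_ (fun j => ?_) j
        · intro _; simpa using (hd i).symm
        · intro h; exact (by simpa using h3 i j (fun heq => h (by rw [heq])))

/-- `G` has no induced copy of `H`. -/
def HFree {k : ℕ} (H : SimpleGraph (Fin k)) {V : Type} (G : SimpleGraph V) : Prop :=
  ¬ ∃ f : Fin k → V, Function.Injective f ∧ ∀ i j, H.Adj i j ↔ G.Adj (f i) (f j)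

/-- Rödl property with parameters `a`, `b`. -/
def RP {k : ℕ} (H : SimpleGraph (Fin k)) (a b : ℝ) : Prop :=
  ∃ δ : ℝ, 0 < δ ∧ ∀ (V : Type) (G : SimpleGraph V), HFree H G → ∀ S : Finset V,
    ∃ X ⊆ S, δ * S.card ≤ X.card ∧
      (eW G X X ≤ a * (X.card : ℝ) ^ 2 ∨ eW Gᶜ X X ≤ b * (X.card : ℝ) ^ 2)

lemma RP_step {k : ℕ} (H : SimpleGraph (Fin k)) (a b : ℝ) (ha : 0 < a) (hb : 0 < b)
    (h1 : RP H (3 / 2 * a) b) (h2 : RP H a (3 / 2 * b)) : RP H a b := by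
  classical
  obtain ⟨δ1, hδ1, h1⟩ := h1
  obtain ⟨δ2, hδ2, h2⟩ := h2
  obtain ⟨γ, hγ, hEH⟩ := EH (min (a / 4) (b / 4)) (by positivity) k
  set δ := min δ1 δ2 with hδdef
  have hδ : 0 < δ := by positivity
  refine ⟨min (1 / (k + 1)) (δ * (γ * (1 / (2 * (k + 1)))) / 2), by positivity, ?_⟩
  intro V G hG S
  have hk : (0 : ℝ) < (k : ℝ) + 1 := by positivity
  rcases Nat.lt_or_ge S.card (k + 1) with hS | hS
  · rcases S.eq_empty_or_nonempty with rfl | ⟨v, hv⟩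
    · exact ⟨∅, subset_rfl, by simp, Or.inl (by simp [eW])⟩
    · refine ⟨{v}, by simpa using hv, ?_, Or.inl (by simp [eW, adjW_self]; positivity)⟩
      have h3 : min (1 / ((k : ℝ) + 1)) (δ * (γ * (1 / (2 * (k + 1)))) / 2) * S.card
          ≤ 1 / ((k : ℝ) + 1) * S.card := mul_le_mul_of_nonneg_right (min_le_left _ _) (by positivity)
      refine h3.trans ?_
      rw [one_div_mul_eq_div, div_le_iff₀ hk]
      have : (S.card : ℝ) < k + 1 := by exact_mod_cast hS
      simp; linarith
  · set m := S.card / (k + 1) with hm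
    have hm1 : 1 ≤ m := (Nat.one_le_div_iff (by omega)).2 hS
    have hmS : (k + 1) * m ≤ S.card := Nat.mul_div_le _ _
    have hmS2 : S.card < (k + 1) * (m + 1) := Nat.lt_mul_div_succ _ (by omega)
    have hmlow : 1 / (2 * ((k : ℝ) + 1)) * S.card ≤ m := by
      rw [one_div_mul_eq_div, div_le_iff₀ (by positivity)]
      have e1 : (S.card : ℝ) < (k + 1) * (m + 1) := by exact_mod_cast hmS2
      have e2 : (1 : ℝ) ≤ m := by exact_mod_cast hm1
      nlinarith
    obtain ⟨P, hP1, hP2, hP3⟩ := exists_parts m k S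
      (le_trans (Nat.mul_le_mul_right _ (by omega)) hmS)
    rcases hEH V G H P m (by exact_mod_cast hm1) (fun i => by rw [hP2]) with
      ⟨f, hf, hadj⟩ | ⟨i, j, hij, A, hA, B, hB, hAc, hBc, hsp⟩
    · exfalso
      apply hG
      refine ⟨f, ?_, ?_⟩
      · intro i j hfij
        by_contra hne
        exact Finset.disjoint_left.1 (hP3 i j hne) (hf i) (hfij ▸ hf j)
      · intro i j
        by_cases h : i = j
        · subst h; simp
        · exact hadj i j h
    · have hdis : Disjoint A B := Finset.disjoint_of_subset_left hA
        (Finset.disjoint_of_subset_right hB (hP3 i j hij))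
      have hsub : A ∪ B ⊆ S := Finset.union_subset (hA.trans (hP1 i)) (hB.trans (hP1 j))
      have hmpos : (0 : ℝ) < m := by exact_mod_cast hm1
      have hfin : min (1 / ((k : ℝ) + 1)) (δ * (γ * (1 / (2 * (k + 1)))) / 2) * S.card
          ≤ δ * (γ * m) / 2 := by
        calc _ ≤ (δ * (γ * (1 / (2 * (k + 1)))) / 2) * S.card :=
              mul_le_mul_of_nonneg_right (min_le_right _ _) (by positivity)
          _ = (δ * γ / 2) * (1 / (2 * ((k : ℝ) + 1)) * S.card) := by ring
          _ ≤ (δ * γ / 2) * m := mul_le_mul_of_nonneg_left hmlow (by positivity)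
          _ = _ := by ring
      rcases hsp with hsp | hsp
      · have hsp' : SparseTo G (a / 4) A B := fun x hx => (hsp x hx).trans
          (mul_le_mul_of_nonneg_right (min_le_left _ _) (by positivity))
        obtain ⟨X, hX, hXc, hXe⟩ := combine G a δ (γ * m) ha hδ (by positivity)
          (fun X => eW Gᶜ X X ≤ b * (X.card : ℝ) ^ 2) A B hdis (fun T => by
            obtain ⟨X, q1, q2, q3⟩ := h1 V G hG T
            exact ⟨X, q1, (mul_le_mul_of_nonneg_right (min_le_left _ _) (by positivity)).trans q2, q3⟩)
          hAc hBc hsp'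
        exact ⟨X, hX.trans hsub, hfin.trans hXc, hXe⟩
      · have hsp' : SparseTo Gᶜ (b / 4) A B := fun x hx => (hsp x hx).trans
          (mul_le_mul_of_nonneg_right (min_le_right _ _) (by positivity))
        obtain ⟨X, hX, hXc, hXe⟩ := combine Gᶜ b δ (γ * m) hb hδ (by positivity)
          (fun X => eW G X X ≤ a * (X.card : ℝ) ^ 2) A B hdis (fun T => by
            obtain ⟨X, q1, q2, q3⟩ := h2 V G hG T
            exact ⟨X, q1, (mul_le_mul_of_nonneg_right (min_le_right _ _) (by positivity)).trans q2,
              q3.symm⟩)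
          hAc hBc hsp'
        exact ⟨X, hX.trans hsub, hfin.trans hXc, hXe.symm⟩

lemma RP_pow {k : ℕ} (H : SimpleGraph (Fin k)) : ∀ (p q : ℕ) (a b : ℝ), 0 < a → 0 < b →
    1 ≤ (3 / 2 : ℝ) ^ p * a → 1 ≤ (3 / 2 : ℝ) ^ q * b → RP H a b := by
  intro p
  induction p with
  | zero =>
    intro q a b ha hb h1 h2
    refine ⟨1, one_pos, fun V G _ S => ⟨S, subset_rfl, by simp, Or.inl ?_⟩⟩
    have := eW_le G S S
    have h0 : (0 : ℝ) ≤ (S.card : ℝ) ^ 2 := by positivity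
    simp at h1
    nlinarith
  | succ p ihp =>
    intro q
    induction q with
    | zero =>
      intro a b ha hb h1 h2
      refine ⟨1, one_pos, fun V G _ S => ⟨S, subset_rfl, by simp, Or.inr ?_⟩⟩
      have := eW_le Gᶜ S S
      have h0 : (0 : ℝ) ≤ (S.card : ℝ) ^ 2 := by positivity
      simp at h2
      nlinarith
    | succ q ihq =>
      intro a b ha hb h1 h2
      refine RP_step H a b ha hb ?_ ?_
      · exact ihp (q + 1) _ _ (by positivity) hb (by rw [pow_succ] at h1; linarith) h2
      · exact ihq _ _ ha (by positivity) h1 (by rw [pow_succ] at h2; linarith)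

/-- Theorem of Rödl, density form. -/
lemma rodl {k : ℕ} (H : SimpleGraph (Fin k)) (a b : ℝ) (ha : 0 < a) (hb : 0 < b) : RP H a b := by
  have key : ∀ x : ℝ, 0 < x → ∃ p : ℕ, 1 ≤ (3 / 2 : ℝ) ^ p * x := by
    intro x hx
    obtain ⟨p, hp⟩ := pow_unbounded_of_one_lt (1 / x) (show (1 : ℝ) < 3 / 2 by norm_num)
    exact ⟨p, by rw [div_lt_iff₀ hx] at hp; exact hp.le⟩
  obtain ⟨p, hp⟩ := key a ha
  obtain ⟨q, hq⟩ := key b hb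
  exact RP_pow H p q a b ha hb hp hq

/-- Non-coherence of the induced graph on a sparse set gives an anticomplete pair. -/
lemma incoh_pair {n : ℕ} (G : SimpleGraph (Fin n)) (ε : ℝ) (hε : 0 < ε) (X : Finset (Fin n))
    (hX : eW G X X ≤ ε / 5 * (X.card : ℝ) ^ 2) (hXne : X.Nonempty)
    (hinc : ∀ (m : ℕ) (e : Fin m ↪ Fin n), ¬ Coherent (G.comap e) ε) :
    X.card ≤ 2 ∨ ∃ A ⊆ X, ∃ B ⊆ X, Disjoint A B ∧ ε / 2 * X.card ≤ A.card ∧ ε / 2 * X.card ≤ B.card ∧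
      ∀ a ∈ A, ∀ b ∈ B, ¬ G.Adj a b := by
  classical
  by_cases hX2 : X.card ≤ 2
  · exact Or.inl hX2
  right
  obtain ⟨Y, hYX, hYc, hYd⟩ := half_low G (ε / 5) X X (by positivity) hXne (by linarith)
  have hXpos : (0 : ℝ) < X.card := by exact_mod_cast hXne.card_pos
  have hX3 : (3 : ℝ) ≤ X.card := by exact_mod_cast (show 3 ≤ X.card by omega)
  have hY2 : 2 ≤ Y.card := by
    have : (1 : ℝ) < Y.card := by linarith
    exact_mod_cast this
  set e : Fin Y.card ↪ Fin n := (Y.orderEmbOfFin rfl).toEmbedding with he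
  have heY : ∀ i, e i ∈ Y := fun i => Y.orderEmbOfFin_mem rfl i
  have h := hinc Y.card e
  unfold Coherent at h
  push Not at h
  obtain ⟨A, B, hAB, hno, hmin⟩ := h hY2 (by
    intro v
    have h1 : (((G.comap e).neighborSet v).ncard : ℝ) ≤ ∑ a ∈ X, adjW G (e v) a := by
      rw [sum_adjW]
      have : ((G.comap e).neighborSet v).ncard ≤ ((X.filter fun b => G.Adj (e v) b) : Set (Fin n)).ncard := by
        refine Set.ncard_le_ncard_of_injOn e ?_ (e.injective.injOn) (Set.toFinite _)
        intro w hw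
        simp only [SimpleGraph.mem_neighborSet, SimpleGraph.comap_adj] at hw
        simp [hw, hYX (heY w)]
      rw [Set.ncard_coe_finset] at this
      exact_mod_cast this
    have h2 := hYd (e v) (heY v)
    nlinarith)
  have hmin' : ε * Y.card ≤ A.card ∧ ε * Y.card ≤ B.card := by
    exact le_min_iff.1 hmin
  refine ⟨A.map e, ?_, B.map e, ?_, ?_, ?_, ?_, ?_⟩
  · intro x hx
    obtain ⟨i, -, rfl⟩ := Finset.mem_map.1 hx
    exact hYX (heY i)
  · intro x hx
    obtain ⟨i, -, rfl⟩ := Finset.mem_map.1 hx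
    exact hYX (heY i)
  · exact (Finset.disjoint_map e).2 hAB
  · rw [Finset.card_map]; nlinarith
  · rw [Finset.card_map]; nlinarith
  · intro a ha b hb
    obtain ⟨i, hi, rfl⟩ := Finset.mem_map.1 ha
    obtain ⟨j, hj, rfl⟩ := Finset.mem_map.1 hb
    exact hno i hi j hj

/-- clique and stable set with large product inside `S`. -/
def Good {V : Type} (G : SimpleGraph V) (c : ℝ) (x : ℝ) (S : Finset V) : Prop :=
  ∃ K ⊆ S, ∃ L ⊆ S, G.IsClique (K : Set V) ∧ Gᶜ.IsClique (L : Set V) ∧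
    x ^ c ≤ (K.card : ℝ) * L.card

lemma Good.compl {V : Type} {G : SimpleGraph V} {c x : ℝ} {S : Finset V} (h : Good G c x S) :
    Good Gᶜ c x S := by
  obtain ⟨K, hK, L, hL, h1, h2, h3⟩ := h
  exact ⟨L, hL, K, hK, h2, by rwa [compl_compl], by rwa [mul_comm]⟩

lemma good_union {V : Type} (G : SimpleGraph V) (c γ : ℝ) (hc : 0 < c) (hγ : 0 < γ)
    (hγc : 1 / 2 ≤ γ ^ c) (A B S : Finset V) (hA : A ⊆ S) (hB : B ⊆ S) (hd : Disjoint A B)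
    (hAc : γ * S.card ≤ A.card) (hBc : γ * S.card ≤ B.card)
    (hno : ∀ a ∈ A, ∀ b ∈ B, ¬ G.Adj a b)
    (h1 : Good G c A.card A) (h2 : Good G c B.card B) : Good G c S.card S := by
  classical
  obtain ⟨K1, hK1, L1, hL1, a1, a2, a3⟩ := h1
  obtain ⟨K2, hK2, L2, hL2, b1, b2, b3⟩ := h2
  have hL : Gᶜ.IsClique ((L1 ∪ L2 : Finset V) : Set V) := by
    intro x hx y hy hxy
    simp only [Finset.coe_union, Set.mem_union, Finset.mem_coe] at hx hy
    rcases hx with hx | hx <;> rcases hy with hy | hy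
    · exact a2 hx hy hxy
    · exact ⟨hxy, hno x (hL1 hx) y (hL2 hy)⟩
    · exact ⟨hxy, fun h => hno y (hL1 hy) x (hL2 hx) h.symm⟩
    · exact b2 hx hy hxy
  have hLc : ((L1 ∪ L2).card : ℝ) = L1.card + L2.card := by
    rw [Finset.card_union_of_disjoint (Finset.disjoint_of_subset_left hL1
      (Finset.disjoint_of_subset_right hL2 hd))]
    push_cast; rfl
  have hLS : L1 ∪ L2 ⊆ S := Finset.union_subset (hL1.trans hA) (hL2.trans hB)
  have hsum : (S.card : ℝ) ^ c ≤ (K1.card : ℝ) * L1.card + K2.card * L2.card := by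
    have e1 : (γ * S.card) ^ c ≤ (A.card : ℝ) ^ c := Real.rpow_le_rpow (by positivity) hAc hc.le
    have e2 : (γ * S.card) ^ c ≤ (B.card : ℝ) ^ c := Real.rpow_le_rpow (by positivity) hBc hc.le
    have e3 : (γ * S.card) ^ c = γ ^ c * (S.card : ℝ) ^ c := Real.mul_rpow hγ.le (by positivity)
    have e4 : (0 : ℝ) ≤ (S.card : ℝ) ^ c := by positivity
    nlinarith
  have p1 : (0 : ℝ) ≤ L1.card := by positivity
  have p2 : (0 : ℝ) ≤ L2.card := by positivity
  rcases le_total K1.card K2.card with h | h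
  · have h' : (K1.card : ℝ) ≤ K2.card := by exact_mod_cast h
    exact ⟨K2, hK2.trans hB, L1 ∪ L2, hLS, b1, hL, by rw [hLc]; nlinarith⟩
  · have h' : (K2.card : ℝ) ≤ K1.card := by exact_mod_cast h
    exact ⟨K1, hK1.trans hA, L1 ∪ L2, hLS, a1, hL, by rw [hLc]; nlinarith⟩

lemma good_all {V : Type} (G : SimpleGraph V) (c γ : ℝ) (hc : 0 < c) (hγ : 0 < γ)
    (hγc : 1 / 2 ≤ γ ^ c)
    (hpair : ∀ S : Finset V, 2 ≤ S.card → ∃ A ⊆ S, ∃ B ⊆ S, Disjoint A B ∧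
      γ * S.card ≤ A.card ∧ γ * S.card ≤ B.card ∧
      ((∀ a ∈ A, ∀ b ∈ B, ¬ G.Adj a b) ∨ (∀ a ∈ A, ∀ b ∈ B, ¬ Gᶜ.Adj a b))) :
    ∀ S : Finset V, Good G c S.card S := by
  intro S
  induction S using Finset.strongInduction with
  | H S ih =>
    rcases Nat.lt_or_ge S.card 2 with hS | hS
    · rcases S.eq_empty_or_nonempty with rfl | ⟨v, hv⟩
      · exact ⟨∅, subset_rfl, ∅, subset_rfl, by simp, by simp, by simp [Real.zero_rpow hc.ne']⟩
      · have h1 : S.card = 1 := by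
          have := Finset.card_pos.2 ⟨v, hv⟩; omega
        exact ⟨{v}, by simpa using hv, {v}, by simpa using hv, by simp, by simp, by simp [h1]⟩
    · obtain ⟨A, hA, B, hB, hd, hAc, hBc, hor⟩ := hpair S hS
      have hSpos : (0 : ℝ) < γ * S.card := by
        have : (0 : ℝ) < S.card := by exact_mod_cast (by omega : 0 < S.card)
        positivity
      have hAne : A.Nonempty := Finset.card_pos.1 (by exact_mod_cast hSpos.trans_le hAc)
      have hBne : B.Nonempty := Finset.card_pos.1 (by exact_mod_cast hSpos.trans_le hBc)
      have hAS : A ⊂ S := by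
        refine Finset.ssubset_iff_subset_ne.2 ⟨hA, ?_⟩
        rintro rfl
        obtain ⟨b, hb⟩ := hBne
        exact Finset.disjoint_left.1 hd (hB hb) hb
      have hBS : B ⊂ S := by
        refine Finset.ssubset_iff_subset_ne.2 ⟨hB, ?_⟩
        rintro rfl
        obtain ⟨b, hb⟩ := hAne
        exact Finset.disjoint_left.1 hd hb (hA hb)
      rcases hor with h | h
      · exact good_union G c γ hc hγ hγc A B S hA hB hd hAc hBc h (ih A hAS) (ih B hBS)
      · have := (good_union Gᶜ c γ hc hγ hγc A B S hA hB hd hAc hBc h (ih A hAS).compl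
          (ih B hBS).compl).compl
        rwa [compl_compl] at this

lemma exists_exponent (γ : ℝ) (hγ : 0 < γ) : ∃ c : ℝ, 0 < c ∧ 1 / 2 ≤ γ ^ c := by
  obtain ⟨p, hp⟩ := exists_pow_lt_of_lt_one hγ (show (1 / 2 : ℝ) < 1 by norm_num)
  refine ⟨1 / (p + 1), by positivity, ?_⟩
  have h1 : (1 / 2 : ℝ) ^ (p + 1) ≤ γ := by
    rw [pow_succ]
    have : (0 : ℝ) < (1 / 2) ^ p := by positivity
    linarith
  calc (1 / 2 : ℝ) = ((1 / 2 : ℝ) ^ (p + 1)) ^ (1 / ((p : ℝ) + 1)) := by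
        rw [← Real.rpow_natCast, ← Real.rpow_mul (by norm_num)]
        push_cast
        rw [mul_one_div_cancel (by positivity), Real.rpow_one]
    _ ≤ _ := Real.rpow_le_rpow (by positivity) h1 (by positivity)

lemma clique_le {n : ℕ} (G : SimpleGraph (Fin n)) (K : Finset (Fin n)) (h : G.IsClique (K : Set (Fin n))) :
    K.card ≤ sSup {k | ∃ s : Finset (Fin n), G.IsNClique k s} := by
  refine le_csSup ⟨n, ?_⟩ ⟨K, h, rfl⟩
  rintro k ⟨s, hs⟩
  rw [← hs.card_eq]
  simpa using Finset.card_le_univ s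

theorem stmt_3 (I : Set GraphOn) (hI : IsIdeal I) (hproper : ∃ H : GraphOn, H ∉ I)
    (hinc : ∃ ε : ℝ, 0 < ε ∧ ∀ G ∈ I, ¬ Coherent G.2 ε)
    (hinc2 : ∃ ε : ℝ, 0 < ε ∧ ∀ G ∈ I, ¬ Coherent (gCompl G).2 ε) :
    ∃ c : ℝ, 0 < c ∧ ∀ G ∈ I, (G.1 : ℝ) ^ c ≤ (gOmega G * gAlpha G : ℕ) := by
  classical
  obtain ⟨H, hH⟩ := hproper
  obtain ⟨ε1, hε1, hinc⟩ := hinc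
  obtain ⟨ε2, hε2, hinc2⟩ := hinc2
  obtain ⟨δ, hδ, hR⟩ := rodl H.2 (ε1 / 5) (ε2 / 5) (by positivity) (by positivity)
  set γ := min (δ / 2) (min (ε1 / 2 * δ) (ε2 / 2 * δ)) with hγdef
  have hγ : 0 < γ := by positivity
  have g1 : γ ≤ δ / 2 := min_le_left _ _
  have g2 : γ ≤ ε1 / 2 * δ := (min_le_right _ _).trans (min_le_left _ _)
  have g3 : γ ≤ ε2 / 2 * δ := (min_le_right _ _).trans (min_le_right _ _)
  obtain ⟨c, hc, hγc⟩ := exists_exponent γ hγ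
  refine ⟨c, hc, ?_⟩
  rintro ⟨n, G⟩ hG
  have hfree : HFree H.2 G := by
    rintro ⟨f, hf, hadj⟩
    exact hH (hI ⟨n, G⟩ hG H ⟨f, hf, hadj⟩)
  have hmem : ∀ (m : ℕ) (e : Fin m ↪ Fin n), (⟨m, G.comap e⟩ : GraphOn) ∈ I := fun m e =>
    hI ⟨n, G⟩ hG ⟨m, G.comap e⟩ ⟨e, e.injective, fun a b => Iff.rfl⟩
  have hcomp : ∀ (m : ℕ) (e : Fin m ↪ Fin n), Gᶜ.comap e = (G.comap e)ᶜ := by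
    intro m e
    ext a b
    simp
  have hgood := good_all G c γ hc hγ hγc (by
    intro S hS
    have hSpos : (0 : ℝ) < S.card := by exact_mod_cast (by omega : 0 < S.card)
    obtain ⟨X, hXS, hXc, hXe⟩ := hR (Fin n) G hfree S
    have hXne : X.Nonempty := by
      refine Finset.card_pos.1 ?_
      have : (0 : ℝ) < δ * S.card := by positivity
      exact_mod_cast this.trans_le hXc
    have hsmall : X.card ≤ 2 → ∃ A ⊆ S, ∃ B ⊆ S, Disjoint A B ∧
      γ * S.card ≤ A.card ∧ γ * S.card ≤ B.card ∧
      ((∀ a ∈ A, ∀ b ∈ B, ¬ G.Adj a b) ∨ (∀ a ∈ A, ∀ b ∈ B, ¬ Gᶜ.Adj a b)) := by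
      intro h2
      obtain ⟨u, hu, v, hv, huv⟩ := Finset.one_lt_card.1 hS
      have h2' : (X.card : ℝ) ≤ 2 := by exact_mod_cast h2
      have hle : γ * S.card ≤ 1 := by nlinarith
      refine ⟨{u}, by simpa using hu, {v}, by simpa using hv, by simpa using huv,
        by simpa using hle, by simpa using hle, ?_⟩
      by_cases hadj : G.Adj u v
      · right; simp [hadj]
      · left; simpa using hadj
    have hbound : ∀ ε : ℝ, 0 < ε → γ ≤ ε / 2 * δ → γ * S.card ≤ ε / 2 * X.card := by
      intro ε hε hg
      calc γ * S.card ≤ (ε / 2 * δ) * S.card := mul_le_mul_of_nonneg_right hg hSpos.le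
        _ = ε / 2 * (δ * S.card) := by ring
        _ ≤ _ := mul_le_mul_of_nonneg_left hXc (by positivity)
    rcases hXe with hXe | hXe
    · rcases incoh_pair G ε1 hε1 X hXe hXne (fun m e => hinc _ (hmem m e)) with
        h | ⟨A, hA, B, hB, hd, h1, h2, h3⟩
      · exact hsmall h
      · exact ⟨A, hA.trans hXS, B, hB.trans hXS, hd, (hbound ε1 hε1 g2).trans h1,
          (hbound ε1 hε1 g2).trans h2, Or.inl h3⟩
    · rcases incoh_pair Gᶜ ε2 hε2 X hXe hXne (fun m e => by
          rw [hcomp]; exact hinc2 _ (hmem m e)) with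
        h | ⟨A, hA, B, hB, hd, h1, h2, h3⟩
      · exact hsmall h
      · exact ⟨A, hA.trans hXS, B, hB.trans hXS, hd, (hbound ε2 hε2 g3).trans h1,
          (hbound ε2 hε2 g3).trans h2, Or.inr h3⟩)
  obtain ⟨K, -, L, -, hK, hL, hKL⟩ := hgood Finset.univ
  simp only [Finset.card_univ, Fintype.card_fin] at hKL
  refine hKL.trans ?_
  have := Nat.mul_le_mul (clique_le G K hK) (clique_le Gᶜ L hL)
  exact_mod_cast this
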